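/- There exist η > 0, C > 0 and X₀ > 0 such that the following holds for every integer X ≥ X₀. Let L = ⌊X^{θ+η}⌋, and assume α is a real number for which there exist an integer a and a positive integer q with gcd(a, q) = 1, |α − a/q| < q^{−2} and X^{2θ+10η} ≤ q ≤ X^{1−θ−10η}. Then for all reals M, N, U ≥ 1 with M ≤ X^{15/22} and U ≤ L, and all complex coefficients a_m (m ∼ M) and c_l (l a nonzero integer with |l| ∼ U) of modulus at most 1, one has |S₁*| ≤ C·X^{1−2η}, where S₁* = Σ_{m ∼ M} Σ_{n ∼ N, mn ∼ X} Σ_{|l| ∼ U} a_m·c_l·e(α·l·m·n), the sums running over positive integers m, n and nonzero integers l in the indicated ranges. -/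

import Mathlib

open Finset

noncomputable def e (z : ℝ) : ℂ := Complex.exp (2 * Real.pi * Complex.I * z)

noncomputable def nint (x : ℝ) : ℝ := |x - round x|

noncomputable def dyN (Y : ℝ) : Finset ℕ :=
  (Finset.range (⌈Y⌉₊ + 1)).filter fun m => Y/2 ≤ (m:ℝ) ∧ (m:ℝ) < Y

noncomputable def dyZ (Y : ℝ) : Finset ℤ :=
  (Finset.Icc (-(⌈Y⌉₊:ℤ)) (⌈Y⌉₊:ℤ)).filter fun l => l ≠ 0 ∧ Y/2 ≤ |(l:ℝ)| ∧ |(l:ℝ)| < Y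
lemma nint_le_abs_sub_int (x : ℝ) (n : ℤ) : nint x ≤ |x - n| := round_le x n

lemma nint_nonneg (x : ℝ) : 0 ≤ nint x := abs_nonneg _

lemma nint_neg (x : ℝ) : nint (-x) = nint x := by
  apply le_antisymm
  · refine (nint_le_abs_sub_int (-x) (-round x)).trans_eq ?_
    rw [nint, ← abs_neg]; push_cast; ring_nf
  · refine (nint_le_abs_sub_int x (-round (-x))).trans_eq ?_
    rw [nint, ← abs_neg]; push_cast; ring_nf

lemma norm_e (x : ℝ) : ‖e x‖ = 1 := by
  have : e x = Complex.exp (((2 * Real.pi * x : ℝ) : ℂ) * Complex.I) := by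
    rw [e]; congr 1; push_cast; ring
  rw [this, Complex.norm_exp_ofReal_mul_I]

lemma e_add (x y : ℝ) : e (x + y) = e x * e y := by
  rw [e, e, e, ← Complex.exp_add]; congr 1; push_cast; ring

lemma e_sub_int (x : ℝ) (n : ℤ) : e (x - n) = e x := by
  have h : e x = e (x - n) * e n := by rw [← e_add]; congr 1; ring
  have h1 : e n = 1 := by
    rw [e, ← Complex.exp_int_mul_two_pi_mul_I n]; congr 1; push_cast; ring
  rw [h, h1, mul_one]

lemma four_mul_nint_le_norm_e_sub_one (x : ℝ) : 4 * nint x ≤ ‖e x - 1‖ := by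
  rw [← e_sub_int x (round x), nint]
  have hy := abs_sub_round x
  set y := x - round x
  have h1 : e y = Complex.exp (Complex.I * ((2 * Real.pi * y : ℝ) : ℂ)) := by
    rw [e]; congr 1; push_cast; ring
  rw [h1, Complex.norm_exp_I_mul_ofReal_sub_one, Real.norm_eq_abs, abs_mul,
    abs_of_pos (two_pos : (0 : ℝ) < 2)]
  have h2 : |2 * Real.pi * y / 2| ≤ Real.pi / 2 := by
    rw [show 2 * Real.pi * y / 2 = Real.pi * y by ring, abs_mul, abs_of_pos Real.pi_pos]
    nlinarith [Real.pi_pos]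
  have h3 := Real.mul_abs_le_abs_sin h2
  rw [show 2 * Real.pi * y / 2 = Real.pi * y by ring] at h3 ⊢
  rw [abs_mul, abs_of_pos Real.pi_pos, ← mul_assoc, div_mul_cancel₀ _ Real.pi_ne_zero] at h3
  linarith

lemma norm_sum_e_mul_nint_le (β : ℝ) (a b : ℕ) :
    ‖∑ n ∈ Ico a b, e (β * n)‖ * nint β ≤ 1 := by
  rcases le_or_gt b a with hab | hab
  · simp [Ico_eq_empty_of_le hab]
  have h : (∑ n ∈ Ico a b, e (β * n)) * (e β - 1) = e (β * b) - e (β * a) := by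
    rw [← sum_Ico_sub (fun n : ℕ => e (β * n)) hab.le, sum_mul]
    refine sum_congr rfl fun n _ => ?_
    rw [mul_sub, ← e_add, mul_one]
    congr 2; push_cast; ring
  have h1 : ‖∑ n ∈ Ico a b, e (β * n)‖ * ‖e β - 1‖ ≤ 2 := by
    rw [← norm_mul, h]
    refine (norm_sub_le _ _).trans ?_
    rw [norm_e, norm_e]; norm_num
  have h2 := mul_le_mul_of_nonneg_left (four_mul_nint_le_norm_e_sub_one β)
    (norm_nonneg (∑ n ∈ Ico a b, e (β * n)))
  linarith

/-- A sum of `min (Z, 1 / u i)` over points `u i` in `[0, 1/2]` that are `1 / (2 q)`-spaced. -/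
lemma sum_le_of_spaced {ι : Type*} (S : Finset ι) (u f : ι → ℝ) {q : ℕ} (hq : 0 < q) {Z : ℝ}
    (hZ : 0 ≤ Z) (hu0 : ∀ i ∈ S, 0 ≤ u i) (hu1 : ∀ i ∈ S, u i ≤ 1 / 2)
    (hsp : ∀ i ∈ S, ∀ j ∈ S, i ≠ j → 1 / (2 * q : ℝ) ≤ |u i - u j|)
    (hfZ : ∀ i ∈ S, f i ≤ Z) (hfu : ∀ i ∈ S, f i * u i ≤ 1) :
    ∑ i ∈ S, f i ≤ Z + 2 * q * (1 + Real.log q) := by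
  have hq' : (0 : ℝ) < q := by exact_mod_cast hq
  let k : ι → ℕ := fun i => ⌊2 * q * u i⌋₊
  let G : ℕ → ℝ := fun k => if k = 0 then Z else 2 * q / k
  have hk : ∀ i ∈ S, (k i : ℝ) ≤ 2 * q * u i := fun i hi =>
    Nat.floor_le (by have := hu0 i hi; positivity)
  have hinj : Set.InjOn k S := by
    intro i hi j hj hij
    by_contra hne
    have h1 := hsp i hi j hj hne
    have h2 := hk i hi
    have h3 := hk j hj
    have h4 : 2 * q * u i < k i + 1 := Nat.lt_floor_add_one _
    have h5 : 2 * q * u j < k j + 1 := Nat.lt_floor_add_one _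
    rw [hij] at h2 h4
    have h6 : |2 * q * (u i - u j)| < 1 := by rw [abs_lt]; constructor <;> linarith
    rw [abs_mul, abs_of_pos (by positivity : (0 : ℝ) < 2 * q)] at h6
    rw [div_le_iff₀ (by positivity)] at h1
    linarith
  have hG0 : ∀ n, 0 ≤ G n := fun n => by
    by_cases h : n = 0
    · simpa [G, h] using hZ
    · simp only [G, h, if_false]; positivity
  have hfG : ∀ i ∈ S, f i ≤ G (k i) := by
    intro i hi
    by_cases h : k i = 0
    · simpa [G, h] using hfZ i hi
    · simp only [G, h, if_false]
      have hkpos : (0 : ℝ) < k i := by exact_mod_cast Nat.pos_of_ne_zero h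
      have hupos : 0 < u i := by
        have := hkpos.trans_le (hk i hi)
        exact pos_of_mul_pos_right this (by positivity)
      rw [le_div_iff₀ hkpos]
      rcases le_or_gt (f i) 0 with hneg | hpos
      · nlinarith
      · nlinarith [hk i hi, hfu i hi]
  have hsub : S.image k ⊆ range (q + 1) := by
    intro n hn
    obtain ⟨i, hi, rfl⟩ := mem_image.1 hn
    have h1 : (k i : ℝ) ≤ q := (hk i hi).trans (by nlinarith [hu1 i hi])
    rw [mem_range, Nat.lt_succ_iff]
    exact_mod_cast h1
  have hharm : ∑ n ∈ range q, (2 * q / ((n + 1 : ℕ) : ℝ) : ℝ) ≤ 2 * q * (1 + Real.log q) := by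
    have h := harmonic_le_one_add_log q
    rw [harmonic] at h
    push_cast at h
    simp_rw [div_eq_mul_inv, ← mul_sum]
    push_cast
    exact mul_le_mul_of_nonneg_left h (by positivity)
  calc ∑ i ∈ S, f i ≤ ∑ i ∈ S, G (k i) := sum_le_sum hfG
    _ = ∑ n ∈ S.image k, G n := (sum_image hinj).symm
    _ ≤ ∑ n ∈ range (q + 1), G n := sum_le_sum_of_subset_of_nonneg hsub fun n _ _ => hG0 n
    _ ≤ Z + 2 * q * (1 + Real.log q) := by
      rw [sum_range_succ']
      simp only [G, Nat.add_eq_zero_iff, one_ne_zero, and_false, if_false, if_true]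
      linarith

lemma sum_le_of_nint_spaced {ι : Type*} (S : Finset ι) (x f : ι → ℝ) {q : ℕ} (hq : 0 < q) {Z : ℝ}
    (hZ : 0 ≤ Z) (hsp : ∀ i ∈ S, ∀ j ∈ S, i ≠ j → 1 / (2 * q : ℝ) ≤ nint (x i - x j))
    (hfZ : ∀ i ∈ S, f i ≤ Z) (hfx : ∀ i ∈ S, f i * nint (x i) ≤ 1) :
    ∑ i ∈ S, f i ≤ 2 * Z + 4 * q * (1 + Real.log q) := by
  classical
  let y : ι → ℝ := fun i => x i - round (x i)
  have hy : ∀ i, |y i| ≤ 1 / 2 := fun i => abs_sub_round (x i)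
  have hsy : ∀ i ∈ S, ∀ j ∈ S, i ≠ j → 1 / (2 * q : ℝ) ≤ |y i - y j| := by
    intro i hi j hj hij
    refine (hsp i hi j hj hij).trans
      ((nint_le_abs_sub_int _ (round (x i) - round (x j))).trans_eq ?_)
    simp only [y]; push_cast; ring_nf
  have hpos := sum_le_of_spaced (S.filter fun i => 0 ≤ y i) y f hq hZ
    (fun i hi => (mem_filter.1 hi).2) (fun i _ => (le_abs_self _).trans (hy i))
    (fun i hi j hj => hsy i (mem_filter.1 hi).1 j (mem_filter.1 hj).1)
    (fun i hi => hfZ i (mem_filter.1 hi).1) (fun i hi => by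
      have h := hfx i (mem_filter.1 hi).1
      rwa [show nint (x i) = y i from abs_of_nonneg (mem_filter.1 hi).2] at h)
  have hneg := sum_le_of_spaced (S.filter fun i => ¬ 0 ≤ y i) (fun i => -y i) f hq hZ
    (fun i hi => by linarith [(mem_filter.1 hi).2]) (fun i _ => (neg_le_abs _).trans (hy i))
    (fun i hi j hj hij => by
      rw [show -y i - -y j = -(y i - y j) by ring, abs_neg]
      exact hsy i (mem_filter.1 hi).1 j (mem_filter.1 hj).1 hij)
    (fun i hi => hfZ i (mem_filter.1 hi).1) (fun i hi => by
      have h := hfx i (mem_filter.1 hi).1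
      rwa [show nint (x i) = -y i from abs_of_neg (not_le.1 (mem_filter.1 hi).2)] at h)
  rw [← sum_filter_add_sum_filter_not S (fun i => 0 ≤ y i)]
  linarith

lemma one_div_two_mul_le_nint {α : ℝ} {a : ℤ} {q : ℕ} (hq : 0 < q) (haq : Int.gcd a q = 1)
    (hα : |α - a / q| < 1 / (q : ℝ) ^ 2) {d : ℤ} (hd0 : d ≠ 0) (hd : 2 * |d| ≤ q) :
    1 / (2 * q : ℝ) ≤ nint (α * d) := by
  have hq' : (0 : ℝ) < q := by exact_mod_cast hq
  have hne : a * d - round (α * d) * q ≠ 0 := by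
    intro h
    have h1 : (q : ℤ) ∣ d := by
      refine Int.dvd_of_dvd_mul_right_of_gcd_one (b := a) ⟨round (α * d), by linarith⟩ ?_
      rwa [Int.gcd_comm]
    have h2 : (q : ℤ) ≤ |d| := Int.le_of_dvd (abs_pos.2 hd0) ((dvd_abs _ _).2 h1)
    have : 0 < |d| := abs_pos.2 hd0
    omega
  have h1 : (1 : ℝ) ≤ |(a : ℝ) * d - (round (α * d) : ℝ) * q| := by exact_mod_cast Int.one_le_abs hne
  have h2 : (2 : ℝ) * |(d : ℝ)| ≤ q := by exact_mod_cast hd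
  have h3 : |(α - a / q) * (d * q)| ≤ 1 / 2 := by
    rw [abs_mul, abs_mul, abs_of_pos hq']
    calc |α - a / q| * (|(d : ℝ)| * q) ≤ 1 / (q : ℝ) ^ 2 * (q / 2 * q) := by
          gcongr; linarith
      _ = 1 / 2 := by field_simp
  rw [nint, div_le_iff₀ (by positivity)]
  have h4 : |(α * d - round (α * d)) * q| = |α * d - round (α * d)| * q := by
    rw [abs_mul, abs_of_pos hq']
  have h5 : (a * d - round (α * d) * q : ℝ)
      = (α * d - round (α * d)) * q - (α - a / q) * (d * q) := by
    field_simp; ring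
  rw [h5] at h1
  have h6 := h1.trans (abs_sub _ _)
  linarith

/-- The classical bound for `∑_{1 ≤ h ≤ H} min (Z, 1 / ‖α h‖)`. -/
lemma sum_le_of_rational_approx {α : ℝ} {a : ℤ} {q : ℕ} (hq : 0 < q) (haq : Int.gcd a q = 1)
    (hα : |α - a / q| < 1 / (q : ℝ) ^ 2) (H : ℕ) (f : ℕ → ℝ) {Z : ℝ} (hZ : 0 ≤ Z)
    (hfZ : ∀ h, f h ≤ Z) (hfα : ∀ h : ℕ, f h * nint (α * h) ≤ 1) :
    ∑ h ∈ Icc 1 H, f h ≤ 4 * H * Z / q + 8 * (H + q) * (1 + Real.log q) := by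
  have hq' : (0 : ℝ) < q := by exact_mod_cast hq
  have hq1 : (1 : ℝ) ≤ q := by exact_mod_cast hq
  have hlog : 0 ≤ Real.log q := Real.log_nonneg hq1
  set B := (q + 1) / 2 with hB
  have hBpos : 0 < B := by omega
  let S : ℕ → Finset ℕ := fun k => (Icc 1 H).filter fun h => h / B = k
  have hsp : ∀ k, ∀ i ∈ S k, ∀ j ∈ S k, i ≠ j →
      1 / (2 * q : ℝ) ≤ nint (α * i - α * j) := by
    intro k i hi j hj hij
    have h := one_div_two_mul_le_nint hq haq hα (d := (i : ℤ) - j) (by omega) (by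
      have h1 := (mem_filter.1 hi).2
      have h2 := (mem_filter.1 hj).2
      have h3 := Nat.div_add_mod i B
      have h4 := Nat.div_add_mod j B
      have h5 := Nat.mod_lt i hBpos
      have h6 := Nat.mod_lt j hBpos
      rw [h1] at h3
      rw [h2] at h4
      have h7 : |(i : ℤ) - j| ≤ B - 1 := by rw [abs_le]; constructor <;> omega
      omega)
    push_cast at h
    rwa [mul_sub] at h
  have hzero : ∑ h ∈ S 0, f h ≤ 2 * (2 * q) + 4 * q * (1 + Real.log q) := by
    refine sum_le_of_nint_spaced (S 0) (fun h => α * h) f hq (by positivity) (hsp 0)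
      (fun h hh => ?_) (fun h _ => hfα h)
    obtain ⟨h1, h2⟩ := mem_filter.1 hh
    have h3 : h < B := (Nat.div_eq_zero_iff_lt hBpos).1 h2
    have h4 := one_div_two_mul_le_nint hq haq hα (d := (h : ℤ))
      (by have := (mem_Icc.1 h1).1; omega) (by rw [Nat.abs_cast]; omega)
    rw [Int.cast_natCast, div_le_iff₀ (by positivity)] at h4
    rcases le_or_gt (f h) 0 with hneg | hpos
    · linarith
    · nlinarith [hfα h]
  have hk : ∀ k, ∑ h ∈ S k, f h ≤ 2 * Z + 4 * q * (1 + Real.log q) := fun k =>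
    sum_le_of_nint_spaced (S k) (fun h => α * h) f hq hZ (hsp k)
      (fun h _ => hfZ h) (fun h _ => hfα h)
  have hmaps : ∀ h ∈ Icc 1 H, h / B ∈ range (H / B + 1) := by
    intro h hh
    rw [mem_range, Nat.lt_succ_iff]
    exact Nat.div_le_div_right (mem_Icc.1 hh).2
  have hK : ((H / B : ℕ) : ℝ) ≤ 2 * H / q := by
    rw [le_div_iff₀ hq']
    have h1 : H / B * B ≤ H := Nat.div_mul_le_self H B
    have h2 : q ≤ 2 * B := by omega
    have h3 : H / B * q ≤ 2 * H := by nlinarith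
    exact_mod_cast h3
  rw [← sum_fiberwise_of_maps_to hmaps f, sum_range_succ']
  have h1 : ∑ k ∈ range (H / B), ∑ h ∈ S (k + 1), f h
      ≤ 2 * H / q * (2 * Z + 4 * q * (1 + Real.log q)) := by
    refine (sum_le_sum fun k _ => hk (k + 1)).trans ?_
    rw [sum_const, card_range, nsmul_eq_mul]
    gcongr
  have h2 : 2 * H / q * (2 * Z + 4 * q * (1 + Real.log q))
      = 4 * H * Z / q + 8 * H * (1 + Real.log q) := by
    field_simp; ring
  have h3 : 0 ≤ q * Real.log q := by positivity
  calc _ ≤ 2 * H / q * (2 * Z + 4 * q * (1 + Real.log q))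
        + (2 * (2 * q) + 4 * q * (1 + Real.log q)) := add_le_add h1 hzero
    _ ≤ _ := by rw [h2]; nlinarith

lemma mem_dyN {Y : ℝ} {m : ℕ} : m ∈ dyN Y ↔ Y / 2 ≤ m ∧ (m : ℝ) < Y := by
  rw [dyN, mem_filter, mem_range, and_iff_right_iff_imp]
  intro h
  have : m < ⌈Y⌉₊ := Nat.lt_ceil.2 h.2
  omega

lemma card_dyZ_le {U : ℝ} (hU : 1 ≤ U) : (#(dyZ U) : ℝ) ≤ 5 * U := by
  have h1 : #(dyZ U) ≤ 2 * ⌈U⌉₊ + 1 := by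
    refine (card_filter_le _ _).trans ?_
    rw [Int.card_Icc]; omega
  have h2 : (#(dyZ U) : ℝ) ≤ 2 * ⌈U⌉₊ + 1 := by exact_mod_cast h1
  have h3 := Nat.ceil_lt_add_one (by linarith : 0 ≤ U)
  linarith

/-- The inner range `n ∼ N`, `m n ∼ X` is an interval. -/
lemma exists_filter_dyN_eq_Ico (N : ℝ) (X : ℕ) {m : ℕ} (hm : 0 < m) : ∃ a b : ℕ,
    (dyN N).filter (fun n => (X : ℝ) / 2 ≤ ((m * n : ℕ) : ℝ) ∧ ((m * n : ℕ) : ℝ) < X)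
      = Ico a b := by
  have hm' : (0 : ℝ) < m := by exact_mod_cast hm
  refine ⟨max ⌈N / 2⌉₊ ⌈(X : ℝ) / 2 / m⌉₊, min ⌈N⌉₊ ⌈(X : ℝ) / m⌉₊, ?_⟩
  ext n
  rw [mem_filter, mem_dyN, mem_Ico, max_le_iff, lt_min_iff, Nat.ceil_le, Nat.ceil_le,
    Nat.lt_ceil, Nat.lt_ceil, div_le_iff₀ hm', lt_div_iff₀ hm']
  push_cast
  rw [mul_comm (m : ℝ)]
  tauto

/-- Type I estimate, with explicit dependence on the denominator `q`. -/
lemma norm_typeI_sum_le {X : ℕ} (hX : 0 < X) {α : ℝ} {a : ℤ} {q : ℕ} (hq : 0 < q)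
    (haq : Int.gcd a q = 1) (hα : |α - a / q| < 1 / (q : ℝ) ^ 2) {M N U : ℝ} (hM : 1 ≤ M)
    (hU : 1 ≤ U) {am : ℕ → ℂ} {cl : ℤ → ℂ}
    (ham : ∀ m ∈ dyN M, ‖am m‖ ≤ 1) (hcl : ∀ l ∈ dyZ U, ‖cl l‖ ≤ 1) :
    ‖∑ m ∈ dyN M, ∑ n ∈ (dyN N).filter
          (fun n => (X : ℝ) / 2 ≤ ((m * n : ℕ) : ℝ) ∧ ((m * n : ℕ) : ℝ) < (X : ℝ)),
        ∑ l ∈ dyZ U, am m * cl l * e (α * (l : ℝ) * (m : ℝ) * (n : ℝ))‖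
      ≤ 5 * U * (8 * U * X / q + 8 * (U * M + q) * (1 + Real.log q)) := by
  have hq' : (0 : ℝ) < q := by exact_mod_cast hq
  have hX' : (0 : ℝ) < X := by exact_mod_cast hX
  have hlog : 0 ≤ Real.log q := Real.log_nonneg (by exact_mod_cast hq)
  set Z : ℝ := 2 * X / M with hZdef
  have hZ : 0 < Z := by positivity
  let f : ℕ → ℝ := fun h => (max Z⁻¹ (nint (α * h)))⁻¹
  have hmax : ∀ h : ℕ, 0 < max Z⁻¹ (nint (α * h)) := fun h =>
    lt_max_of_lt_left (inv_pos.2 hZ)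
  have hf0 : ∀ h, 0 ≤ f h := fun h => (inv_pos.2 (hmax h)).le
  have hfZ : ∀ h, f h ≤ Z := fun h => inv_le_of_inv_le₀ hZ (le_max_left _ _)
  have hfα : ∀ h : ℕ, f h * nint (α * h) ≤ 1 := fun h => by
    rw [inv_mul_le_iff₀ (hmax h), mul_one]; exact le_max_right _ _
  have hle : ∀ (h : ℕ) (t : ℝ), t ≤ Z → t * nint (α * h) ≤ 1 → t ≤ f h := by
    intro h t h1 h2
    simp only [f]
    rw [← one_div, le_div_iff₀ (hmax h)]
    rcases max_choice Z⁻¹ (nint (α * h)) with h3 | h3 <;> rw [h3]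
    · rwa [mul_inv_le_iff₀ hZ, one_mul]
    · exact h2
  have hmpos : ∀ m ∈ dyN M, 0 < m := fun m hm => by
    have := (mem_dyN.1 hm).1
    have h : (0 : ℝ) < m := by linarith
    exact_mod_cast h
  have hinner : ∀ m ∈ dyN M, ∀ l ∈ dyZ U,
      ‖∑ n ∈ (dyN N).filter
          (fun n => (X : ℝ) / 2 ≤ ((m * n : ℕ) : ℝ) ∧ ((m * n : ℕ) : ℝ) < (X : ℝ)),
        e (α * (l : ℝ) * (m : ℝ) * (n : ℝ))‖ ≤ f (l.natAbs * m) := by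
    intro m hm l _
    have hm0 : (0 : ℝ) < m := by exact_mod_cast hmpos m hm
    have hm1 := (mem_dyN.1 hm).1
    apply hle
    · refine (norm_sum_le _ _).trans ?_
      simp only [norm_e, sum_const, nsmul_eq_mul, mul_one]
      have hsub : (dyN N).filter
          (fun n => (X : ℝ) / 2 ≤ ((m * n : ℕ) : ℝ) ∧ ((m * n : ℕ) : ℝ) < (X : ℝ))
          ⊆ Icc 1 ⌊Z⌋₊ := by
        intro n hn
        obtain ⟨-, h1, h2⟩ := mem_filter.1 hn
        push_cast at h1 h2
        rw [mem_Icc]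
        have hn0 : (0 : ℝ) < n := pos_of_mul_pos_right (by linarith : (0 : ℝ) < m * n) hm0.le
        refine ⟨by exact_mod_cast hn0, Nat.le_floor ?_⟩
        rw [hZdef, le_div_iff₀ (by linarith)]
        nlinarith
      have hcard := card_le_card hsub
      rw [Nat.card_Icc, Nat.add_sub_cancel] at hcard
      exact (by exact_mod_cast hcard : _ ≤ ((⌊Z⌋₊ : ℕ) : ℝ)).trans (Nat.floor_le hZ.le)
    · obtain ⟨b, b', hb⟩ := exists_filter_dyN_eq_Ico N X (hmpos m hm)
      rw [hb]
      have hnint : nint (α * ((l.natAbs * m : ℕ) : ℝ)) = nint (α * l * m) := by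
        rw [Nat.cast_mul, Nat.cast_natAbs, Int.cast_abs, ← mul_assoc]
        rcases abs_choice (l : ℝ) with h | h <;> rw [h]
        rw [mul_neg, neg_mul, nint_neg]
      rw [hnint]
      exact norm_sum_e_mul_nint_le _ _ _
  have hsum : ∀ l ∈ dyZ U, ∑ m ∈ dyN M, f (l.natAbs * m) ≤ ∑ h ∈ Icc 1 ⌊U * M⌋₊, f h := by
    intro l hl
    obtain ⟨-, hl0, -, hlU⟩ := mem_filter.1 hl
    have hlpos : 0 < l.natAbs := Int.natAbs_pos.2 hl0
    rw [← sum_image (s := dyN M) (g := fun m => l.natAbs * m) (f := f)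
      (fun m _ m' _ h => Nat.eq_of_mul_eq_mul_left hlpos h)]
    refine sum_le_sum_of_subset_of_nonneg (fun h hh => ?_) fun h _ _ => hf0 h
    obtain ⟨m, hm, rfl⟩ := mem_image.1 hh
    refine mem_Icc.2 ⟨Nat.mul_pos hlpos (hmpos m hm), Nat.le_floor ?_⟩
    rw [Nat.cast_mul, Nat.cast_natAbs, Int.cast_abs]
    exact mul_le_mul hlU.le (mem_dyN.1 hm).2.le (by positivity) (by linarith)
  have hbound := sum_le_of_rational_approx hq haq hα ⌊U * M⌋₊ f hZ.le hfZ hfα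
  have hH : (⌊U * M⌋₊ : ℝ) ≤ U * M := Nat.floor_le (by positivity)
  have hswap : ‖∑ m ∈ dyN M, ∑ n ∈ (dyN N).filter
          (fun n => (X : ℝ) / 2 ≤ ((m * n : ℕ) : ℝ) ∧ ((m * n : ℕ) : ℝ) < (X : ℝ)),
        ∑ l ∈ dyZ U, am m * cl l * e (α * (l : ℝ) * (m : ℝ) * (n : ℝ))‖
      ≤ ∑ m ∈ dyN M, ∑ l ∈ dyZ U, f (l.natAbs * m) := by
    refine norm_sum_le_of_le _ fun m hm => ?_
    rw [sum_comm]
    refine norm_sum_le_of_le _ fun l hl => ?_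
    rw [← mul_sum, norm_mul, norm_mul]
    have h1 : ‖am m‖ * ‖cl l‖ ≤ 1 := mul_le_one₀ (ham m hm) (norm_nonneg _) (hcl l hl)
    exact (mul_le_of_le_one_left (norm_nonneg _) h1).trans (hinner m hm l hl)
  refine hswap.trans ?_
  rw [sum_comm]
  refine (sum_le_sum hsum).trans ?_
  rw [sum_const, nsmul_eq_mul]
  have hHZ : 4 * (U * M) * Z / q = 8 * U * X / q := by
    rw [hZdef]; field_simp; ring
  refine mul_le_mul (card_dyZ_le hU) ?_ (sum_nonneg fun h _ => hf0 h) (by linarith)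
  rw [← hHZ]
  refine hbound.trans ?_
  gcongr

/-- The Type I bound holds for every `η` in `(0, 1/100]`, with constants depending only on `η`. -/
lemma norm_typeI_sum_le_rpow {θ η : ℝ} (hθ1 : 0 < θ) (hθ2 : θ < 1 / 10) (hη0 : 0 < η)
    (hη1 : η ≤ 1 / 100) {X : ℕ} (hX : 0 < X) {α : ℝ} {a : ℤ} {q : ℕ} (hq : 0 < q)
    (haq : Int.gcd a q = 1) (hα : |α - a / q| < 1 / (q : ℝ) ^ 2)
    (hq1 : (X : ℝ) ^ (2 * θ + 10 * η) ≤ q) (hq2 : (q : ℝ) ≤ (X : ℝ) ^ (1 - θ - 10 * η))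
    {M N U : ℝ} (hM : 1 ≤ M) (hU : 1 ≤ U) (hMX : M ≤ (X : ℝ) ^ ((15 : ℝ) / 22))
    (hUX : U ≤ (X : ℝ) ^ (θ + η)) {am : ℕ → ℂ} {cl : ℤ → ℂ}
    (ham : ∀ m ∈ dyN M, ‖am m‖ ≤ 1) (hcl : ∀ l ∈ dyZ U, ‖cl l‖ ≤ 1) :
    ‖∑ m ∈ dyN M, ∑ n ∈ (dyN N).filter
          (fun n => (X : ℝ) / 2 ≤ ((m * n : ℕ) : ℝ) ∧ ((m * n : ℕ) : ℝ) < (X : ℝ)),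
        ∑ l ∈ dyZ U, am m * cl l * e (α * (l : ℝ) * (m : ℝ) * (n : ℝ))‖
      ≤ (120 + 80 / η) * (X : ℝ) ^ (1 - 2 * η) := by
  have hX1 : (1 : ℝ) ≤ X := by exact_mod_cast hX
  have hX0 : (0 : ℝ) < X := by linarith
  have hq' : (0 : ℝ) < q := by exact_mod_cast hq
  have hlog0 : 0 ≤ Real.log q := Real.log_nonneg (by exact_mod_cast hq)
  have hqX : (q : ℝ) ≤ X := hq2.trans
    ((Real.rpow_le_rpow_of_exponent_le hX1 (by linarith)).trans_eq (Real.rpow_one _))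
  have hlog : 1 + Real.log q ≤ (1 + 1 / η) * (X : ℝ) ^ η := by
    have h1 := Real.log_le_log hq' hqX
    have h2 := Real.log_le_rpow_div hX0.le hη0
    have h3 := Real.one_le_rpow hX1 hη0.le
    calc 1 + Real.log q ≤ (X : ℝ) ^ η + (X : ℝ) ^ η / η := by linarith
      _ = _ := by ring
  have h1 : U * (U * X / q) ≤ (X : ℝ) ^ (1 - 2 * η) := by
    calc U * (U * X / q) ≤ (X : ℝ) ^ (θ + η) * ((X : ℝ) ^ (θ + η) * (X : ℝ) ^ (1 : ℝ)
            / (X : ℝ) ^ (2 * θ + 10 * η)) := by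
          rw [Real.rpow_one]; gcongr
      _ = (X : ℝ) ^ (1 - 8 * η) := by
          rw [← Real.rpow_add hX0, ← Real.rpow_sub hX0, ← Real.rpow_add hX0]; congr 1; ring
      _ ≤ _ := Real.rpow_le_rpow_of_exponent_le hX1 (by linarith)
  have h2 : U * (U * M) * (X : ℝ) ^ η ≤ (X : ℝ) ^ (1 - 2 * η) := by
    calc U * (U * M) * (X : ℝ) ^ η
        ≤ (X : ℝ) ^ (θ + η) * ((X : ℝ) ^ (θ + η) * (X : ℝ) ^ ((15 : ℝ) / 22)) * (X : ℝ) ^ η := by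
          gcongr
      _ = (X : ℝ) ^ (2 * θ + 3 * η + 15 / 22) := by
          rw [← Real.rpow_add hX0, ← Real.rpow_add hX0, ← Real.rpow_add hX0]; congr 1; ring
      _ ≤ _ := Real.rpow_le_rpow_of_exponent_le hX1 (by linarith)
  have h3 : U * q * (X : ℝ) ^ η ≤ (X : ℝ) ^ (1 - 2 * η) := by
    calc U * q * (X : ℝ) ^ η
        ≤ (X : ℝ) ^ (θ + η) * (X : ℝ) ^ (1 - θ - 10 * η) * (X : ℝ) ^ η := by gcongr
      _ = (X : ℝ) ^ (1 - 8 * η) := by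
          rw [← Real.rpow_add hX0, ← Real.rpow_add hX0]; congr 1; ring
      _ ≤ _ := Real.rpow_le_rpow_of_exponent_le hX1 (by linarith)
  refine (norm_typeI_sum_le hX hq haq hα hM hU ham hcl).trans ?_
  calc 5 * U * (8 * U * X / q + 8 * (U * M + q) * (1 + Real.log q))
      ≤ 5 * U * (8 * U * X / q + 8 * (U * M + q) * ((1 + 1 / η) * (X : ℝ) ^ η)) := by gcongr
    _ = 40 * (U * (U * X / q))
        + 40 * (1 + 1 / η) * (U * (U * M) * (X : ℝ) ^ η + U * q * (X : ℝ) ^ η) := by ring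
    _ ≤ 40 * (X : ℝ) ^ (1 - 2 * η)
        + 40 * (1 + 1 / η) * ((X : ℝ) ^ (1 - 2 * η) + (X : ℝ) ^ (1 - 2 * η)) := by gcongr
    _ = _ := by ring

theorem S1_bound (c γ θ : ℝ) (hc1 : 1 < c) (hc2 : c < 9/8) (hγ : γ = 1/c)
    (hθ1 : 0 < θ) (hθ2 : θ < (9*γ - 8)/10) :
    ∃ η > (0:ℝ), ∃ C > (0:ℝ), ∃ X₀ > (0:ℝ), ∀ X : ℕ, X₀ ≤ (X:ℝ) →
    ∀ α : ℝ, (∃ a : ℤ, ∃ q : ℕ, 0 < q ∧ Int.gcd a (q:ℤ) = 1 ∧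
        |α - (a:ℝ)/(q:ℝ)| < 1/(q:ℝ)^2 ∧
        (X:ℝ)^(2*θ+10*η) ≤ (q:ℝ) ∧ (q:ℝ) ≤ (X:ℝ)^(1-θ-10*η)) →
    ∀ M N U : ℝ, 1 ≤ M → 1 ≤ N → 1 ≤ U →
    M ≤ (X:ℝ)^((15:ℝ)/22) → U ≤ (⌊(X:ℝ)^(θ+η)⌋₊ : ℝ) →
    ∀ am : ℕ → ℂ, ∀ cl : ℤ → ℂ,
    (∀ m ∈ dyN M, ‖am m‖ ≤ 1) → (∀ l ∈ dyZ U, ‖cl l‖ ≤ 1) →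
    ‖∑ m ∈ dyN M, ∑ n ∈ (dyN N).filter (fun n => (X:ℝ)/2 ≤ ((m*n:ℕ):ℝ) ∧ ((m*n:ℕ):ℝ) < (X:ℝ)),
        ∑ l ∈ dyZ U, am m * cl l * e (α * (l:ℝ) * (m:ℝ) * (n:ℝ))‖ ≤ C * (X:ℝ)^(1-2*η) := by
  have hθ3 : θ < 1 / 10 := by
    have h : 1 / c < 1 := by rw [div_lt_one (by linarith)]; exact hc1
    rw [← hγ] at h
    linarith
  refine ⟨1 / 100, by norm_num, 120 + 80 / (1 / 100), by norm_num, 1, one_pos, ?_⟩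
  rintro X hX α ⟨a, q, hq, haq, hα, hq1, hq2⟩ M N U hM hN hU hMX hUL am cl ham hcl
  exact norm_typeI_sum_le_rpow hθ1 hθ3 (by norm_num) le_rfl (by exact_mod_cast hX) hq haq hα
    hq1 hq2 hM hU hMX (hUL.trans (Nat.floor_le (by positivity))) ham hcl
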